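/- Let n ≥ 1, let β ≥ (n−1)/2, let M > 0, and let f : ℝⁿ → ℝ be smooth with support contained in the open ball B_M(0). Let C₀ > 0 and let F be a square-integrable function on S^{n−1} × [−M, M] such that |(Rf)(θ, η)| ≤ C₀ · F(θ, η) for almost every (θ, η) ∈ S^{n−1} × [−M, M]. Then ∫_{ℝⁿ} (1 + ‖ξ‖²)^{−β} |f̂(ξ)|² dξ ≤ 2π · C₀² · ∫_{S^{n−1}} ∫_{−M}^{M} |F(θ, η)|² dη dθ, i.e. the H^{−β}(ℝⁿ) norm of f is bounded by (2π)^{1/2} C₀ times the L² norm of F. -/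

import Mathlib

open MeasureTheory Real
open scoped RealInnerProductSpace

/-- The Radon transform of `f : ℝⁿ → ℝ`: for a unit vector `θ` and `η ∈ ℝ`,
`(Rf)(θ, η) = ∫_{y ∈ θ^⊥} f(ηθ + y) dy`, an integral over the hyperplane
`{x : x·θ = η}` with respect to the Lebesgue measure of the orthogonal
complement `θ^⊥`. -/
noncomputable def radonTransform {n : ℕ} (f : EuclideanSpace ℝ (Fin n) → ℝ)
    (θ : EuclideanSpace ℝ (Fin n)) (η : ℝ) : ℝ :=
  ∫ y : (ℝ ∙ θ)ᗮ, f (η • θ + (y : EuclideanSpace ℝ (Fin n)))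

/-- The (non-normalized) Fourier transform `f̂(ξ) = ∫ e^{-i x·ξ} f(x) dx`. -/
noncomputable def fourierT {n : ℕ} (f : EuclideanSpace ℝ (Fin n) → ℝ)
    (ξ : EuclideanSpace ℝ (Fin n)) : ℂ :=
  ∫ x : EuclideanSpace ℝ (Fin n), Complex.exp (-Complex.I * (⟪x, ξ⟫ : ℝ)) * (f x : ℂ)



lemma radon_norm_le {n : ℕ} {θ : EuclideanSpace ℝ (Fin n)} (y : (ℝ ∙ θ)ᗮ) (η : ℝ) (hθ : ‖θ‖ = 1) :
    ‖(y : EuclideanSpace ℝ (Fin n))‖ ≤ ‖η • θ + (y : EuclideanSpace ℝ (Fin n))‖ ∧ |η| ≤ ‖η • θ + (y : EuclideanSpace ℝ (Fin n))‖ := by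
  have h0 : ⟪η • θ, (y : EuclideanSpace ℝ (Fin n))⟫ = 0 := by
    rw [real_inner_smul_left, Submodule.mem_orthogonal_singleton_iff_inner_right.1 y.2, mul_zero]
  have h := norm_add_sq_eq_norm_sq_add_norm_sq_of_inner_eq_zero _ _ h0
  have h1 : ‖η • θ‖ = |η| := by rw [norm_smul, hθ, mul_one, Real.norm_eq_abs]
  rw [h1] at h
  constructor <;> refine le_of_sq_le_sq ?_ (norm_nonneg _) <;> nlinarith [norm_nonneg (y : EuclideanSpace ℝ (Fin n)), abs_nonneg η]

lemma radon_mp {n : ℕ} {θ : EuclideanSpace ℝ (Fin n)} (hθ : ‖θ‖ = 1) :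
    MeasurePreserving (fun p : ℝ × (ℝ ∙ θ)ᗮ => p.1 • θ + (p.2 : EuclideanSpace ℝ (Fin n))) volume volume := by
  have h1 := (LinearIsometryEquiv.measurePreserving (LinearIsometryEquiv.toSpanUnitSingleton θ hθ)).prod
    (MeasurePreserving.id (volume : Measure (ℝ ∙ θ)ᗮ))
  have h2 := WithLp.volume_preserving_toLp (ℝ ∙ θ) (ℝ ∙ θ)ᗮ
  have h3 := LinearIsometryEquiv.measurePreserving (ℝ ∙ θ).orthogonalDecomposition.symm
  have h := h3.comp (h2.comp h1)
  have e : (fun p : ℝ × (ℝ ∙ θ)ᗮ => p.1 • θ + (p.2 : EuclideanSpace ℝ (Fin n))) =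
      ⇑(ℝ ∙ θ).orthogonalDecomposition.symm ∘
        WithLp.toLp 2 ∘ Prod.map (⇑(LinearIsometryEquiv.toSpanUnitSingleton θ hθ)) id := by
    ext1 p
    rfl
  rw [e]
  exact h

lemma radon_fubini {n : ℕ} {θ : EuclideanSpace ℝ (Fin n)} (hθ : ‖θ‖ = 1) (G : (EuclideanSpace ℝ (Fin n)) → ℂ) (hG : Integrable G) :
    ∫ x, G x = ∫ η : ℝ, ∫ y : (ℝ ∙ θ)ᗮ, G (η • θ + (y : EuclideanSpace ℝ (Fin n))) := by
  have h := radon_mp hθ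
  have hi := h.integrable_comp_of_integrable hG
  rw [← h.map_eq, integral_map h.measurable.aemeasurable (by rw [h.map_eq]; exact hG.1)]
  exact integral_prod _ hi

lemma radon_compact {E : Type*} [NormedAddCommGroup E] [ProperSpace E] {F : Type*} [Zero F] {M : ℝ} {f : E → F} (hs : ∀ x, M < ‖x‖ → f x = 0) :
    HasCompactSupport f := by
  refine HasCompactSupport.intro (isCompact_closedBall (0 : E) M) fun x hx => hs x ?_
  simpa using hx

lemma radon_int {n : ℕ} {M : ℝ} {θ : EuclideanSpace ℝ (Fin n)} (hθ : ‖θ‖ = 1) (f : (EuclideanSpace ℝ (Fin n)) → ℝ)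
    (hf : Continuous f) (hs : ∀ x, M < ‖x‖ → f x = 0) (η : ℝ) :
    Integrable (fun y : (ℝ ∙ θ)ᗮ => f (η • θ + (y : EuclideanSpace ℝ (Fin n)))) := by
  refine Continuous.integrable_of_hasCompactSupport (by fun_prop) ?_
  refine radon_compact (M := M) fun y hy => hs _ ?_
  exact lt_of_lt_of_le hy (radon_norm_le y η hθ).1

lemma radon_deriv {n : ℕ} {M : ℝ} {θ : EuclideanSpace ℝ (Fin n)} (hθ : ‖θ‖ = 1) (f : (EuclideanSpace ℝ (Fin n)) → ℝ)
    (hf : ContDiff ℝ (⊤ : ℕ∞) f) (hs : ∀ x, M < ‖x‖ → f x = 0) :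
    ContDiff ℝ (⊤ : ℕ∞) (fun x => fderiv ℝ f x θ) ∧ (∀ x, M < ‖x‖ → fderiv ℝ f x θ = 0) ∧
    ∀ η, HasDerivAt (radonTransform f θ) (radonTransform (fun x => fderiv ℝ f x θ) θ η) η := by
  have hd : ContDiff ℝ (⊤ : ℕ∞) (fun x => fderiv ℝ f x θ) :=
    (hf.fderiv_right (by simp)).clm_apply contDiff_const
  have hz : ∀ x, M < ‖x‖ → fderiv ℝ f x θ = 0 := by
    intro x hx
    have : f =ᶠ[nhds x] fun _ => 0 := by
      filter_upwards [(isOpen_lt continuous_const continuous_norm).mem_nhds hx] with z hz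
      exact hs z hz
    rw [this.fderiv_eq]; simp
  refine ⟨hd, hz, fun η => ?_⟩
  obtain ⟨C, hC⟩ := (radon_compact hz).exists_bound_of_continuous hd.continuous
  have hmeas : ∀ η', AEStronglyMeasurable (fun y : (ℝ ∙ θ)ᗮ => f (η' • θ + (y : EuclideanSpace ℝ (Fin n)))) volume :=
    fun η' => (radon_int hθ f hf.continuous hs η').1
  have := hasDerivAt_integral_of_dominated_loc_of_deriv_le (μ := (volume : Measure (ℝ ∙ θ)ᗮ))
    (F := fun η y => f (η • θ + (y : EuclideanSpace ℝ (Fin n))))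
    (F' := fun η y => fderiv ℝ f (η • θ + (y : EuclideanSpace ℝ (Fin n))) θ) (x₀ := η) (s := Set.univ)
    (bound := (Metric.closedBall (0 : (ℝ ∙ θ)ᗮ) M).indicator fun _ => C) Filter.univ_mem
    (Filter.Eventually.of_forall hmeas) (radon_int hθ f hf.continuous hs η)
    (radon_int hθ _ hd.continuous hz η).1 ?_ ?_ ?_
  · exact this.2
  · refine Filter.Eventually.of_forall fun y x _ => ?_
    by_cases hy : y ∈ Metric.closedBall (0 : (ℝ ∙ θ)ᗮ) M
    · rw [Set.indicator_of_mem hy]; exact hC _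
    · rw [Set.indicator_of_notMem hy, hz, norm_zero]
      have hy' : M < ‖y‖ := by simpa using hy
      exact lt_of_lt_of_le hy' (radon_norm_le y x hθ).1
  · rw [integrable_indicator_iff Metric.isClosed_closedBall.measurableSet]
    exact integrableOn_const (isCompact_closedBall _ _).measure_lt_top.ne
  · refine Filter.Eventually.of_forall fun y x _ => ?_
    have h1 : HasDerivAt (fun η : ℝ => η • θ + (y : EuclideanSpace ℝ (Fin n))) θ x := by
      simpa using ((hasDerivAt_id x).smul_const θ).add_const (y : EuclideanSpace ℝ (Fin n))
    exact ((hf.differentiable (by simp)) _).hasFDerivAt.comp_hasDerivAt x h1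

lemma radon_smooth {n : ℕ} {M : ℝ} {θ : EuclideanSpace ℝ (Fin n)} (hθ : ‖θ‖ = 1) (k : ℕ) : ∀ (f : (EuclideanSpace ℝ (Fin n)) → ℝ)
    (_ : ContDiff ℝ (⊤ : ℕ∞) f) (_ : ∀ x, M < ‖x‖ → f x = 0),
    ContDiff ℝ k (radonTransform f θ) := by
  induction k with
  | zero =>
    intro f hf hs
    rw [Nat.cast_zero, contDiff_zero, continuous_iff_continuousAt]
    exact fun η => ((radon_deriv hθ f hf hs).2.2 η).continuousAt
  | succ k ih =>
    intro f hf hs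
    obtain ⟨h1, h2, h3⟩ := radon_deriv hθ f hf hs
    rw [Nat.cast_succ, contDiff_succ_iff_deriv]
    refine ⟨fun η => (h3 η).differentiableAt, by simp, ?_⟩
    rw [show deriv (radonTransform f θ) = _ from funext fun η => (h3 η).deriv]
    exact ih _ h1 h2

lemma radon_zero {n : ℕ} {M : ℝ} {θ : EuclideanSpace ℝ (Fin n)} (hθ : ‖θ‖ = 1) (f : (EuclideanSpace ℝ (Fin n)) → ℝ)
    (hs : ∀ x, M < ‖x‖ → f x = 0) (η : ℝ) (hη : M < ‖η‖) : radonTransform f θ η = 0 := by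
  unfold radonTransform
  refine integral_eq_zero_of_ae (Filter.Eventually.of_forall fun y => hs _ ?_)
  exact lt_of_lt_of_le hη (radon_norm_le y η hθ).2

open FourierTransform in
lemma radon_fourier {V : Type*} [NormedAddCommGroup V] [InnerProductSpace ℝ V]
    [FiniteDimensional ℝ V] [MeasurableSpace V] [BorelSpace V] (g : V → ℂ) (ξ : V) :
    ∫ x, Complex.exp (-Complex.I * (⟪x, ξ⟫ : ℝ)) * g x = 𝓕 g ((2 * π)⁻¹ • ξ) := by
  rw [Real.fourier_eq']
  congr 1; ext x
  rw [smul_eq_mul, real_inner_smul_right]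
  congr 2
  push_cast
  have : (π : ℂ) ≠ 0 := by exact_mod_cast Real.pi_ne_zero
  field_simp

lemma radon_slice {n : ℕ} {M : ℝ} {θ : EuclideanSpace ℝ (Fin n)} (hθ : ‖θ‖ = 1) (f : (EuclideanSpace ℝ (Fin n)) → ℝ)
    (hf : ContDiff ℝ (⊤ : ℕ∞) f) (hs : ∀ x, M < ‖x‖ → f x = 0) (r : ℝ) :
    fourierT f (r • θ) = ∫ η : ℝ, Complex.exp (-Complex.I * (⟪η, r⟫ : ℝ)) *
      (radonTransform f θ η : ℂ) := by
  unfold fourierT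
  rw [radon_fubini hθ]
  · congr 1; ext η
    unfold radonTransform
    rw [← integral_complex_ofReal, ← integral_const_mul]
    congr 1; ext y
    congr 3
    rw [inner_add_left, real_inner_smul_left, real_inner_smul_right, real_inner_smul_right,
      real_inner_self_eq_norm_sq, hθ, real_inner_comm,
      Submodule.mem_orthogonal_singleton_iff_inner_right.1 y.2]
    simp
    try ring
  · refine Continuous.integrable_of_hasCompactSupport (by have := hf.continuous; fun_prop) ?_
    refine radon_compact (M := M) fun y hy => by simp [hs y hy]

open FourierTransform in
lemma radon_plancherel {n : ℕ} {M : ℝ} {θ : EuclideanSpace ℝ (Fin n)} (hθ : ‖θ‖ = 1) (f : (EuclideanSpace ℝ (Fin n)) → ℝ)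
    (hf : ContDiff ℝ (⊤ : ℕ∞) f) (hs : ∀ x, M < ‖x‖ → f x = 0) :
    Integrable (fun r : ℝ => ‖fourierT f (r • θ)‖ ^ 2) ∧
    ∫ r : ℝ, ‖fourierT f (r • θ)‖ ^ 2 = 2 * π * ∫ η in Set.Icc (-M) M, radonTransform f θ η ^ 2 := by
  have hR : ContDiff ℝ (⊤ : ℕ∞) (radonTransform f θ) :=
    contDiff_infty.2 fun k => radon_smooth hθ k f hf hs
  have hz := radon_zero hθ f hs
  have hR' : ContDiff ℝ (⊤ : ℕ∞) (fun η => (radonTransform f θ η : ℂ)) :=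
    Complex.ofRealCLM.contDiff.comp hR
  have hc : HasCompactSupport (fun η => (radonTransform f θ η : ℂ)) :=
    radon_compact (M := M) fun y hy => by simp [hz y hy]
  let S := hc.toSchwartzMap hR'
  have hS : ∀ r : ℝ, fourierT f (r • θ) = (𝓕 S) ((2 * π)⁻¹ * r) := by
    intro r
    rw [radon_slice hθ f hf hs, radon_fourier, SchwartzMap.fourier_coe]
    rfl
  simp_rw [hS]
  have h2 : Integrable fun x => ‖(𝓕 S) x‖ ^ 2 := 
    ((𝓕 S).memLp 2 volume).integrable_norm_pow (by norm_num)
  refine ⟨h2.comp_mul_left' (by positivity), ?_⟩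
  have h3 := Measure.integral_comp_mul_left (fun x : ℝ => ‖(𝓕 S) x‖ ^ 2) (2 * π)⁻¹
  rw [h3, SchwartzMap.integral_norm_sq_fourier,
    inv_inv, abs_of_pos (by positivity), smul_eq_mul,
    setIntegral_eq_integral_of_forall_compl_eq_zero]
  · congr 2; ext x
    change ‖(radonTransform f θ x : ℂ)‖ ^ 2 = _
    simp
  · intro x hx
    rw [hz, zero_pow two_ne_zero]
    by_contra h
    exact hx (abs_le.1 (not_lt.1 h))

lemma radon_cont {n : ℕ} {M : ℝ} (f : (EuclideanSpace ℝ (Fin n)) → ℝ)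
    (hf : ContDiff ℝ (⊤ : ℕ∞) f) (hs : ∀ x, M < ‖x‖ → f x = 0) : Continuous (fourierT f) := by
  have hR' : ContDiff ℝ (⊤ : ℕ∞) (fun x => (f x : ℂ)) := Complex.ofRealCLM.contDiff.comp hf
  have hc : HasCompactSupport (fun x => (f x : ℂ)) :=
    radon_compact (M := M) fun y hy => by simp [hs y hy]
  let S := hc.toSchwartzMap hR'
  have : fourierT f = fun ξ => (FourierTransform.fourier S) ((2 * π)⁻¹ • ξ) := by
    ext ξ
    rw [SchwartzMap.fourier_coe]
    exact radon_fourier _ ξ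
  rw [this]
  exact (SchwartzMap.continuous _).comp (continuous_const_smul _)

lemma radon_polar {n : ℕ} (hn : 1 ≤ n) (g : (EuclideanSpace ℝ (Fin n)) → ENNReal) (hg : Measurable g) :
    ∫⁻ x, g x = ∫⁻ θ : Metric.sphere (0 : EuclideanSpace ℝ (Fin n)) 1, ∫⁻ r in Set.Ioi (0 : ℝ),
      ENNReal.ofReal (r ^ (n - 1)) * g (r • (θ : EuclideanSpace ℝ (Fin n)))
      ∂volume ∂(volume : Measure (EuclideanSpace ℝ (Fin n))).toSphere := by
  have : Nonempty (Fin n) := ⟨⟨0, hn⟩⟩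
  have h := (volume : Measure (EuclideanSpace ℝ (Fin n))).measurePreserving_homeomorphUnitSphereProd
  have h2 := h.lintegral_comp_emb (Homeomorph.measurableEmbedding _)
    (fun p => g (p.2.1 • (p.1 : EuclideanSpace ℝ (Fin n))))
  have e : ∀ x : ({0}ᶜ : Set (EuclideanSpace ℝ (Fin n))), g ((homeomorphUnitSphereProd (EuclideanSpace ℝ (Fin n)) x).2.1 •
    ((homeomorphUnitSphereProd (EuclideanSpace ℝ (Fin n)) x).1 : EuclideanSpace ℝ (Fin n))) = g x := by
    intro x
    congr 1
    exact congrArg Subtype.val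
      ((homeomorphUnitSphereProd (EuclideanSpace ℝ (Fin n))).symm_apply_apply x)
  simp_rw [e] at h2
  rw [lintegral_subtype_comap (measurableSet_singleton _).compl, restrict_compl_singleton] at h2
  rw [h2, lintegral_prod _ (by fun_prop)]
  refine lintegral_congr fun θ => ?_
  rw [Measure.volumeIoiPow, lintegral_withDensity_eq_lintegral_mul _ (by fun_prop) (by fun_prop)]
  simp only [Pi.mul_apply, finrank_euclideanSpace, Fintype.card_fin]
  exact lintegral_subtype_comap measurableSet_Ioi
    (fun r => ENNReal.ofReal (r ^ (n - 1)) * g (r • (θ : EuclideanSpace ℝ (Fin n))))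

/-- **`H^{-β}` bound by the `L²` norm of a Radon-transform majorant.**
If `f` is smooth with support in the ball `B_M(0)`, `β ≥ (n-1)/2`, and
`|(Rf)(θ,η)| ≤ C₀ F(θ,η)` a.e. on `S^{n-1} × [-M,M]` for a square-integrable
`F`, then `‖f‖²_{H^{-β}} ≤ 2π C₀² ‖F‖²_{L²(S^{n-1} × [-M,M])}`. -/
theorem sobolev_neg_norm_le_of_radon_bound
    (n : ℕ) (hn : 1 ≤ n) (β M : ℝ) (hβ : ((n : ℝ) - 1) / 2 ≤ β) (hM : 0 < M)
    (f : EuclideanSpace ℝ (Fin n) → ℝ) (hf : ContDiff ℝ (⊤ : ℕ∞) f)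
    (hsupp : Function.support f ⊆ Metric.ball (0 : EuclideanSpace ℝ (Fin n)) M)
    (C₀ : ℝ) (hC₀ : 0 < C₀)
    (F : Metric.sphere (0 : EuclideanSpace ℝ (Fin n)) 1 × ℝ → ℝ)
    (hF : MemLp F 2
      (((volume : Measure (EuclideanSpace ℝ (Fin n))).toSphere).prod
        (volume.restrict (Set.Icc (-M) M))))
    (hbound : ∀ᵐ p ∂(((volume : Measure (EuclideanSpace ℝ (Fin n))).toSphere).prod
        (volume.restrict (Set.Icc (-M) M))),
      |radonTransform f (p.1 : EuclideanSpace ℝ (Fin n)) p.2| ≤ C₀ * F p) :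
    ∫ ξ : EuclideanSpace ℝ (Fin n),
        (1 + ‖ξ‖ ^ 2) ^ (-β) * ‖fourierT f ξ‖ ^ 2
      ≤ 2 * π * C₀ ^ 2 *
        ∫ θ : Metric.sphere (0 : EuclideanSpace ℝ (Fin n)) 1,
          (∫ η in Set.Icc (-M) M, F (θ, η) ^ 2)
          ∂(volume : Measure (EuclideanSpace ℝ (Fin n))).toSphere := by
  have hs : ∀ x, M < ‖x‖ → f x = 0 := by
    intro x hx
    by_contra h
    have := hsupp h
    rw [mem_ball_zero_iff] at this
    linarith
  have hcont := radon_cont f hf hs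
  have hsq : Integrable (fun p => F p ^ 2) (((volume : Measure (EuclideanSpace ℝ (Fin n))).toSphere).prod
        (volume.restrict (Set.Icc (-M) M))) := hF.integrable_sq
  have hgc : Continuous fun ξ : EuclideanSpace ℝ (Fin n) =>
      (1 + ‖ξ‖ ^ 2) ^ (-β) * ‖fourierT f ξ‖ ^ 2 := by
    refine Continuous.mul (Continuous.rpow_const (by fun_prop) fun x => Or.inl (by positivity)) (by fun_prop)
  have hR0 : 0 ≤ 2 * π * C₀ ^ 2 *
        ∫ θ : Metric.sphere (0 : EuclideanSpace ℝ (Fin n)) 1,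
          (∫ η in Set.Icc (-M) M, F (θ, η) ^ 2)
          ∂(volume : Measure (EuclideanSpace ℝ (Fin n))).toSphere := by
    have : 0 ≤ ∫ θ : Metric.sphere (0 : EuclideanSpace ℝ (Fin n)) 1,
          (∫ η in Set.Icc (-M) M, F (θ, η) ^ 2)
          ∂(volume : Measure (EuclideanSpace ℝ (Fin n))).toSphere :=
      integral_nonneg fun θ => integral_nonneg fun η => sq_nonneg _
    positivity
  rw [integral_eq_lintegral_of_nonneg_ae (Filter.Eventually.of_forall fun ξ => by positivity)
    hgc.aestronglyMeasurable]
  refine ENNReal.toReal_le_of_le_ofReal hR0 ?_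
  rw [radon_polar hn _ (by fun_prop), ← integral_const_mul,
    ofReal_integral_eq_lintegral_ofReal (hsq.integral_prod_left.const_mul _)
      (Filter.Eventually.of_forall fun θ => mul_nonneg (by positivity)
        (integral_nonneg fun η => sq_nonneg _))]
  refine lintegral_mono_ae ?_
  filter_upwards [Measure.ae_ae_of_ae_prod hbound, hsq.prod_right_ae] with θ hb hi
  have hθ : ‖(θ : EuclideanSpace ℝ (Fin n))‖ = 1 := by simp
  obtain ⟨hp1, hp2⟩ := radon_plancherel hθ f hf hs
  calc _ ≤ ∫⁻ r in Set.Ioi (0 : ℝ), ENNReal.ofReal (‖fourierT f (r • (θ : EuclideanSpace ℝ (Fin n)))‖ ^ 2) := by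
        refine setLIntegral_mono' measurableSet_Ioi fun r hr => ?_
        have hr' : (0 : ℝ) < r := hr
        rw [← ENNReal.ofReal_mul (by positivity)]
        refine ENNReal.ofReal_le_ofReal ?_
        rw [← mul_assoc]
        refine mul_le_of_le_one_left (by positivity) ?_
        rw [norm_smul, hθ, mul_one, Real.norm_eq_abs, sq_abs, Real.rpow_neg (by positivity),
          ← div_eq_mul_inv, div_le_one (by positivity)]
        calc r ^ (n - 1) = (r ^ 2) ^ (((n : ℝ) - 1) / 2) := by
              rw [← Real.rpow_natCast, ← Real.rpow_natCast, ← Real.rpow_mul hr'.le]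
              congr 1
              push_cast [hn]
              ring
          _ ≤ (1 + r ^ 2) ^ (((n : ℝ) - 1) / 2) := by
              have : (1 : ℝ) ≤ n := by exact_mod_cast hn
              exact Real.rpow_le_rpow (by positivity) (by linarith) (by linarith)
          _ ≤ (1 + r ^ 2) ^ β := Real.rpow_le_rpow_of_exponent_le (by nlinarith) hβ
    _ ≤ ∫⁻ r, ENNReal.ofReal (‖fourierT f (r • (θ : EuclideanSpace ℝ (Fin n)))‖ ^ 2) :=
        setLIntegral_le_lintegral _ _
    _ = ENNReal.ofReal (2 * π * ∫ η in Set.Icc (-M) M, radonTransform f θ η ^ 2) := by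
        rw [← hp2, ofReal_integral_eq_lintegral_ofReal hp1
          (Filter.Eventually.of_forall fun r => by positivity)]
    _ ≤ _ := by
        refine ENNReal.ofReal_le_ofReal ?_
        rw [mul_assoc (2 * π)]
        refine mul_le_mul_of_nonneg_left ?_ (by positivity)
        rw [← integral_const_mul]
        refine integral_mono_of_nonneg (Filter.Eventually.of_forall fun η => sq_nonneg _)
          (hi.const_mul _) ?_
        filter_upwards [hb] with η h
        rw [← mul_pow, ← sq_abs]
        exact pow_le_pow_left₀ (abs_nonneg _) h 2
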